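/- Let ε ∈ (0,1) and let ψ, ψ̄ ∈ ℕ^τ satisfy (1−ε)·ψ̄^t ≤ ψ^t ≤ ψ̄^t for every type t. If the type-symmetric lottery allocation (x̃_1,…,x̃_τ) is ordinally efficient for the type economy E(c, ψ̄), then there exists c′ ∈ ℝ^m with (1−ε)·c ≤ c′ ≤ (1+ε)·c coordinatewise such that (x̃_1,…,x̃_τ) is ordinally efficient for the type economy E(c′, ψ). -/

import Mathlib

open Finset
open scoped Classical

noncomputable section

/-- A bundle of the `m` goods. -/
abbrev Bundle (m : ℕ) := Fin m → ℕ

/-- `μ` is a finitely supported probability distribution on the finite set `Ψt`. -/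
def IsLottery {m : ℕ} (Ψt : Finset (Bundle m)) (μ : Bundle m → ℝ) : Prop :=
  (∀ x, 0 ≤ μ x) ∧ (∀ x, x ∉ Ψt → μ x = 0) ∧ ∑ x ∈ Ψt, μ x = 1

/-- The probability, under `μ`, of the weak upper contour set of `z` for the strict
order `pr` on `Ψt`. -/
def upProb {m : ℕ} (Ψt : Finset (Bundle m)) (pr : Bundle m → Bundle m → Prop)
    (μ : Bundle m → ℝ) (z : Bundle m) : ℝ :=
  ∑ x ∈ Ψt, if x = z ∨ pr x z then μ x else 0

/-- `μ` first-order stochastically dominates `ν` with respect to the strict order `pr`. -/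
def SDge {m : ℕ} (Ψt : Finset (Bundle m)) (pr : Bundle m → Bundle m → Prop)
    (μ ν : Bundle m → ℝ) : Prop :=
  ∀ z ∈ Ψt, upProb Ψt pr ν z ≤ upProb Ψt pr μ z

/-- The type-symmetric lottery allocation `xt` (one lottery per type, given to each of the
`φ t` agents of type `t`) is ordinally efficient for the type economy with capacities `cc`:
it is feasible and there is no feasible (not necessarily type-symmetric) profile of lotteries
over the agents `(t : Fin τ) × Fin (φ t)` in which every agent's lottery stochastically
dominates their assigned lottery, strictly for at least one agent. -/
def OrdEff {m : ℕ} {τ : ℕ} (Ψ : Fin τ → Finset (Bundle m))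
    (pref : Fin τ → Bundle m → Bundle m → Prop)
    (cc : Fin m → ℝ) (φ : Fin τ → ℕ) (xt : Fin τ → Bundle m → ℝ) : Prop :=
  (∀ j, ∑ t, (φ t : ℝ) * ∑ x ∈ Ψ t, xt t x * (x j : ℝ) ≤ cc j) ∧
  ¬ ∃ y : ((t : Fin τ) × Fin (φ t)) → Bundle m → ℝ,
      (∀ a, IsLottery (Ψ a.1) (y a)) ∧
      (∀ j, ∑ a : (t : Fin τ) × Fin (φ t), ∑ x ∈ Ψ a.1, y a x * (x j : ℝ) ≤ cc j) ∧
      (∀ a, SDge (Ψ a.1) (pref a.1) (y a) (xt a.1)) ∧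
      (∃ a : (t : Fin τ) × Fin (φ t), ∃ z ∈ Ψ a.1,
        upProb (Ψ a.1) (pref a.1) (xt a.1) z < upProb (Ψ a.1) (pref a.1) (y a) z)

/-- Summing `f` over an initial segment and the constant `r` over the rest of `Fin N`. -/
theorem sum_fin_extend_const {n N : ℕ} (h : n ≤ N) (f : Fin n → ℝ) (r : ℝ) :
    ∑ i : Fin N, (if hi : (i : ℕ) < n then f ⟨i, hi⟩ else r) =
      ∑ i : Fin n, f i + ((N : ℝ) - n) * r := by
  obtain ⟨k, rfl⟩ := Nat.exists_eq_add_of_le h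
  rw [Fin.sum_univ_add]
  simp

/-- **Efficiency under type-count discrepancy** (Lemma A.3): if `(1-ε)·ψ̄ ≤ ψ ≤ ψ̄`
coordinatewise and the type-symmetric lottery allocation `xt` is ordinally efficient for the
type economy `E(c, ψ̄)`, then there is a capacity vector `c'` with `(1-ε)·c ≤ c' ≤ (1+ε)·c`
such that `xt` is ordinally efficient for the type economy `E(c', ψ)`. -/
theorem efficiency_type_discrepancy
    (m τ Δ : ℕ) (hΔ : 0 < Δ)
    (c : Fin m → ℕ)
    (Ψ : Fin τ → Finset (Bundle m))
    (hzero : ∀ t, (0 : Bundle m) ∈ Ψ t)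
    (hsize : ∀ t, ∀ x ∈ Ψ t, ∑ j, x j ≤ Δ)
    (pref : Fin τ → Bundle m → Bundle m → Prop)
    (hirr : ∀ t, ∀ x ∈ Ψ t, ¬ pref t x x)
    (htrans : ∀ t, ∀ x ∈ Ψ t, ∀ y ∈ Ψ t, ∀ z ∈ Ψ t,
        pref t x y → pref t y z → pref t x z)
    (htotal : ∀ t, ∀ x ∈ Ψ t, ∀ y ∈ Ψ t, x ≠ y → pref t x y ∨ pref t y x)
    (hleast : ∀ t, ∀ x ∈ Ψ t, x ≠ 0 → pref t x 0)
    (ε : ℝ) (hε0 : 0 < ε) (hε1 : ε < 1)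
    (ψ ψbar : Fin τ → ℕ)
    (hlow : ∀ t, (1 - ε) * (ψbar t : ℝ) ≤ (ψ t : ℝ))
    (hhigh : ∀ t, ψ t ≤ ψbar t)
    (xt : Fin τ → Bundle m → ℝ)
    (hxt : ∀ t, IsLottery (Ψ t) (xt t))
    (heff : OrdEff Ψ pref (fun j => (c j : ℝ)) ψbar xt) :
    ∃ c' : Fin m → ℝ,
      (∀ j, (1 - ε) * (c j : ℝ) ≤ c' j ∧ c' j ≤ (1 + ε) * (c j : ℝ)) ∧
      OrdEff Ψ pref c' ψ xt := by
  obtain ⟨hfeas, hund⟩ := heff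
  set E : Fin τ → Fin m → ℝ := fun t j => ∑ x ∈ Ψ t, xt t x * (x j : ℝ) with hE
  have hE0 : ∀ t j, 0 ≤ E t j := fun t j =>
    Finset.sum_nonneg fun x _ => mul_nonneg ((hxt t).1 x) (Nat.cast_nonneg _)
  have hsplit : ∀ j, ∑ t, ((ψbar t : ℝ) - ψ t) * E t j =
      ∑ t, (ψbar t : ℝ) * E t j - ∑ t, (ψ t : ℝ) * E t j := fun j => by
    rw [← Finset.sum_sub_distrib]
    exact Finset.sum_congr rfl fun t _ => by ring
  refine ⟨fun j => (c j : ℝ) - ∑ t, ((ψbar t : ℝ) - ψ t) * E t j, fun j => ⟨?_, ?_⟩,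
    fun j => ?_, ?_⟩
  · have h1 : ∑ t, ((ψbar t : ℝ) - ψ t) * E t j ≤ ε * ∑ t, (ψbar t : ℝ) * E t j := by
      rw [Finset.mul_sum]
      refine Finset.sum_le_sum fun t _ => ?_
      rw [← mul_assoc]
      exact mul_le_mul_of_nonneg_right (by linarith [hlow t]) (hE0 t j)
    have h2 := mul_le_mul_of_nonneg_left (hfeas j) hε0.le
    linarith
  · have h1 : 0 ≤ ∑ t, ((ψbar t : ℝ) - ψ t) * E t j :=
      Finset.sum_nonneg fun t _ =>
        mul_nonneg (sub_nonneg.2 (Nat.cast_le.2 (hhigh t))) (hE0 t j)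
    have h2 : 0 ≤ ε * (c j : ℝ) := by positivity
    linarith
  · have h1 := hfeas j
    have h2 := hsplit j
    simp only [hE] at h2 ⊢
    linarith
  · rintro ⟨y, hlot, hcap, hdom, ⟨t₀, i₀⟩, z, hz, hlt⟩
    refine hund ⟨fun a => if h : (a.2 : ℕ) < ψ a.1 then y ⟨a.1, ⟨a.2, h⟩⟩ else xt a.1,
      fun a => ?_, fun j => ?_, fun a => ?_,
      ⟨t₀, Fin.castLE (hhigh t₀) i₀⟩, z, hz, ?_⟩
    · dsimp only
      split_ifs with h
      · exact hlot ⟨a.1, ⟨a.2, h⟩⟩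
      · exact hxt a.1
    · have key : ∀ t, ∑ i : Fin (ψbar t), ∑ x ∈ Ψ t,
          (if h : (i : ℕ) < ψ t then y ⟨t, ⟨i, h⟩⟩ else xt t) x * (x j : ℝ) =
          ∑ i : Fin (ψ t), ∑ x ∈ Ψ t, y ⟨t, i⟩ x * (x j : ℝ) +
            ((ψbar t : ℝ) - ψ t) * E t j := fun t => by
        rw [← sum_fin_extend_const (hhigh t)]
        refine Finset.sum_congr rfl fun i _ => ?_
        split_ifs <;> rfl
      have h1 := hcap j
      rw [Fintype.sum_sigma] at h1 ⊢
      simp only [key, Finset.sum_add_distrib]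
      linarith
    · dsimp only
      split_ifs with h
      · exact hdom ⟨a.1, ⟨a.2, h⟩⟩
      · exact fun _ _ => le_rfl
    · simpa using hlt
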